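/- For Gessel's model, the three-variate generating function Q(x,y;t) is algebraic: there exists a nonzero polynomial P ∈ ℚ[x,y,t,u] such that P(x, y, t, Q(x,y;t)) = 0 in the formal power series ring ℚ[[x,y,t]]. -/

import Mathlib

/-- The set of quadrant walks of length `n` from `(0,0)` to `(i,j)` with steps in `S`. -/
def quadWalks (S : Set (ℤ × ℤ)) (i j n : ℕ) : Set (List (ℤ × ℤ)) :=
  {w | w.length = n ∧ (∀ s ∈ w, s ∈ S) ∧
    (∀ k, 0 ≤ ((w.take k).map Prod.fst).sum ∧ 0 ≤ ((w.take k).map Prod.snd).sum) ∧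
    (w.map Prod.fst).sum = i ∧ (w.map Prod.snd).sum = j}

/-- The number `q(i,j;n)` of quadrant walks of length `n` from `(0,0)` to `(i,j)`. -/
noncomputable def q (S : Set (ℤ × ℤ)) (i j n : ℕ) : ℕ := Nat.card (quadWalks S i j n)

/-- The generating function `Q(x,y;t) = Σ q(i,j;n) x^i y^j t^n`, as a formal power
series in the three variables `x = X 0`, `y = X 1`, `t = X 2`. -/
noncomputable def Q (S : Set (ℤ × ℤ)) : MvPowerSeries (Fin 3) ℚ :=
  fun d => (q S (d 0) (d 1) (d 2) : ℚ)

/-- Gessel's step set. -/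
def gesselSteps : Set (ℤ × ℤ) := {(1, 0), (1, 1), (-1, 0), (-1, -1)}


namespace Gessel

open Polynomial

/-- Gessel walks ending at an integer point. -/
def gwalk (a b : ℤ) (n : ℕ) : Set (List (ℤ × ℤ)) :=
  {w | w.length = n ∧ (∀ s ∈ w, s ∈ gesselSteps) ∧
    (∀ k, 0 ≤ ((w.take k).map Prod.fst).sum ∧ 0 ≤ ((w.take k).map Prod.snd).sum) ∧
    (w.map Prod.fst).sum = a ∧ (w.map Prod.snd).sum = b}

noncomputable def c (a b : ℤ) (n : ℕ) : ℕ := (gwalk a b n).ncard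

lemma q_eq (i j n : ℕ) : q gesselSteps i j n = c i j n := rfl

lemma gwalk_zero (a b : ℤ) : gwalk a b 0 = if a = 0 ∧ b = 0 then {[]} else ∅ := by
  ext w
  simp only [gwalk, Set.mem_setOf_eq, List.length_eq_zero_iff]
  split_ifs with h
  · obtain ⟨rfl, rfl⟩ := h
    constructor
    · rintro ⟨h, -⟩; simpa using h
    · intro h
      have : w = [] := by simpa using h
      subst this; simp
  · constructor
    · rintro ⟨rfl, -, -, h1, h2⟩
      exact (h ⟨by simpa using h1.symm, by simpa using h2.symm⟩).elim
    · intro h; simp at h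

lemma gwalk_neg (a b : ℤ) (n : ℕ) (h : a < 0 ∨ b < 0) : gwalk a b n = ∅ := by
  ext w
  simp only [gwalk, Set.mem_setOf_eq, Set.mem_empty_iff_false, iff_false]
  rintro ⟨-, -, h3, h1, h2⟩
  have := h3 w.length
  rw [List.take_length, h1, h2] at this
  omega

lemma mem_gwalk_snoc (a b : ℤ) (ha : 0 ≤ a) (hb : 0 ≤ b) (n : ℕ) (w : List (ℤ × ℤ)) (s : ℤ × ℤ) :
    w ++ [s] ∈ gwalk a b (n + 1) ↔ s ∈ gesselSteps ∧ w ∈ gwalk (a - s.1) (b - s.2) n := by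
  simp only [gwalk, Set.mem_setOf_eq, List.length_append, List.length_singleton,
    List.map_append, List.sum_append, List.map_cons, List.map_nil, List.sum_cons, List.sum_nil,
    add_zero, List.mem_append, List.mem_singleton]
  constructor
  · rintro ⟨h1, h2, h3, h4, h5⟩
    refine ⟨h2 s (Or.inr rfl), by omega, fun s' hs' => h2 s' (Or.inl hs'), fun k => ?_, by omega,
      by omega⟩
    have := h3 (min k w.length)
    rw [List.take_append_of_le_length (by omega)] at this
    rcases le_total k w.length with hk | hk
    · rwa [min_eq_left hk] at this
    · rw [min_eq_right hk, List.take_length] at this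
      rwa [List.take_of_length_le hk]
  · rintro ⟨hs, h1, h2, h3, h4, h5⟩
    refine ⟨by omega, ?_, fun k => ?_, by omega, by omega⟩
    · rintro s' (h | rfl)
      · exact h2 s' h
      · exact hs
    · rcases le_or_gt k w.length with hk | hk
      · rw [List.take_append_of_le_length hk]; exact h3 k
      · rw [List.take_of_length_le (by simp; omega)]
        simp only [List.map_append, List.sum_append, List.map_cons, List.map_nil, List.sum_cons,
          List.sum_nil, add_zero]
        omega

lemma gwalk_succ (a b : ℤ) (ha : 0 ≤ a) (hb : 0 ≤ b) (n : ℕ) :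
    gwalk a b (n + 1) =
      (((fun w => w ++ [((1 : ℤ), (0 : ℤ))]) '' gwalk (a - 1) b n ∪
      (fun w => w ++ [((1 : ℤ), (1 : ℤ))]) '' gwalk (a - 1) (b - 1) n) ∪
      (fun w => w ++ [((-1 : ℤ), (0 : ℤ))]) '' gwalk (a + 1) b n) ∪
      (fun w => w ++ [((-1 : ℤ), (-1 : ℤ))]) '' gwalk (a + 1) (b + 1) n := by
  ext w
  rcases List.eq_nil_or_concat w with rfl | ⟨w, s, rfl⟩
  · constructor
    · rintro ⟨h, -⟩; simp at h
    · rintro (((⟨v, _, h⟩ | ⟨v, _, h⟩) | ⟨v, _, h⟩) | ⟨v, _, h⟩) <;> simp at h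
  · simp only [List.concat_eq_append]
    rw [mem_gwalk_snoc a b ha hb]
    simp only [gesselSteps, Set.mem_insert_iff, Set.mem_singleton_iff, Set.mem_union, Set.mem_image]
    constructor
    · rintro ⟨rfl | rfl | rfl | rfl, h⟩
      · exact Or.inl (Or.inl (Or.inl ⟨w, by simpa using h, rfl⟩))
      · exact Or.inl (Or.inl (Or.inr ⟨w, by simpa using h, rfl⟩))
      · exact Or.inl (Or.inr ⟨w, by simpa using h, rfl⟩)
      · exact (Or.inr ⟨w, by simpa using h, rfl⟩)
    · rintro (((⟨v, hv, h⟩ | ⟨v, hv, h⟩) | ⟨v, hv, h⟩) | ⟨v, hv, h⟩) <;>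
      · obtain ⟨rfl, h2⟩ := List.append_inj' h rfl
        obtain rfl : _ = s := by simpa using h2
        simpa using hv

lemma gwalk_finite (n : ℕ) : ∀ a b : ℤ, (gwalk a b n).Finite := by
  induction n with
  | zero => intro a b; rw [gwalk_zero]; split_ifs <;> simp
  | succ n ih =>
    intro a b
    by_cases h : a < 0 ∨ b < 0
    · rw [gwalk_neg a b _ h]; simp
    · rw [gwalk_succ a b (by omega) (by omega)]
      exact ((((ih _ _).image _).union ((ih _ _).image _)).union ((ih _ _).image _)).union
        ((ih _ _).image _)

lemma c_neg (a b : ℤ) (n : ℕ) (h : a < 0 ∨ b < 0) : c a b n = 0 := by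
  simp [c, gwalk_neg a b n h]

lemma c_zero (a b : ℤ) : c a b 0 = if a = 0 ∧ b = 0 then 1 else 0 := by
  rw [c, gwalk_zero]; split_ifs <;> simp

lemma c_succ (a b : ℤ) (ha : 0 ≤ a) (hb : 0 ≤ b) (n : ℕ) :
    c a b (n + 1) = c (a - 1) b n + c (a - 1) (b - 1) n + c (a + 1) b n + c (a + 1) (b + 1) n := by
  have inj : ∀ s : ℤ × ℤ, Function.Injective (fun w : List (ℤ × ℤ) => w ++ [s]) := by
    intro s v w h; exact (List.append_inj' h rfl).1
  have dis : ∀ (s s' : ℤ × ℤ) (A B : Set (List (ℤ × ℤ))), s ≠ s' →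
      Disjoint ((fun w : List (ℤ × ℤ) => w ++ [s]) '' A) ((fun w => w ++ [s']) '' B) := by
    intro s s' A B h
    rw [Set.disjoint_left]
    rintro _ ⟨v, _, rfl⟩ ⟨w, _, h'⟩
    have := (List.append_inj' h' rfl).2
    simp at this
    exact h this.symm
  have fin := gwalk_finite n
  unfold c
  rw [gwalk_succ a b ha hb, Set.ncard_union_eq _ ((((fin _ _).image _).union
    ((fin _ _).image _)).union ((fin _ _).image _)) ((fin _ _).image _),
    Set.ncard_union_eq _ (((fin _ _).image _).union ((fin _ _).image _)) ((fin _ _).image _),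
    Set.ncard_union_eq _ ((fin _ _).image _) ((fin _ _).image _)]
  · simp only [Set.ncard_image_of_injective _ (inj _)]
  · exact dis _ _ _ _ (by simp)
  · exact Disjoint.union_left (dis _ _ _ _ (by simp)) (dis _ _ _ _ (by simp))
  · exact Disjoint.union_left (Disjoint.union_left (dis _ _ _ _ (by simp))
      (dis _ _ _ _ (by simp))) (dis _ _ _ _ (by simp))

lemma c_big (n : ℕ) : ∀ a b : ℤ, (n < a ∨ n < b) → c a b n = 0 := by
  induction n with
  | zero =>
    intro a b h
    rw [c_zero, if_neg]; push_cast at h; omega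
  | succ n ih =>
    intro a b h
    push_cast at h
    by_cases h' : a < 0 ∨ b < 0
    · exact c_neg a b _ h'
    · rw [c_succ a b (by omega) (by omega), ih _ _ (by omega), ih _ _ (by omega),
        ih _ _ (by omega), ih _ _ (by omega)]

/-- Generating polynomial of walks of length `n`: outer variable `y`, inner variable `x`. -/
noncomputable def Qn (n : ℕ) : ℚ[X][X] :=
  ∑ j ∈ Finset.range (n + 1), ∑ i ∈ Finset.range (n + 1),
    monomial j (monomial i (c i j n : ℚ))

noncomputable def Rn (n : ℕ) : ℚ[X] :=
  ∑ i ∈ Finset.range (n + 1), monomial i (c i 0 n : ℚ)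

noncomputable def Sn (n : ℕ) : ℚ[X] :=
  ∑ j ∈ Finset.range (n + 1), monomial j (c 0 j n : ℚ)

lemma Rn_coeff (n i : ℕ) : (Rn n).coeff i = c i 0 n := by
  simp only [Rn, finset_sum_coeff, coeff_monomial, Finset.sum_ite_eq', Finset.mem_range]
  split_ifs with h
  · rfl
  · rw [c_big]; · simp
    left; exact_mod_cast (by omega : n < i)

lemma Sn_coeff (n i : ℕ) : (Sn n).coeff i = c 0 i n := by
  simp only [Sn, finset_sum_coeff, coeff_monomial, Finset.sum_ite_eq', Finset.mem_range]
  split_ifs with h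
  · rfl
  · rw [c_big]; · simp
    right; exact_mod_cast (by omega : n < i)

lemma Qn_coeff (n i j : ℕ) : ((Qn n).coeff j).coeff i = c i j n := by
  simp only [Qn, finset_sum_coeff, coeff_monomial]
  by_cases hj : j < n + 1
  · rw [Finset.sum_eq_single j]
    · simp only [if_true, coeff_monomial, Finset.sum_ite_eq', Finset.mem_range]
      split_ifs with h
      · rfl
      · rw [c_big]; · simp
        left; exact_mod_cast (by omega : n < i)
    · intro b _ hb; simp [hb]
    · intro h; simp at h; omega
  · rw [c_big _ _ _ (Or.inr (by exact_mod_cast (by omega : n < j)))]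
    simp only [Nat.cast_zero]
    apply Finset.sum_eq_zero
    intro b hb
    have : b ≠ j := by simp at hb; omega
    simp [this]

lemma Qn_zero : Qn 0 = 1 := by
  simp [Qn, c_zero]

lemma Qn_rec (n : ℕ) :
    X * (C X * Qn (n + 1)) = Qn n + X * Qn n + C X * (C X * (X * Qn n)) +
      C X * (C X * (X * (X * Qn n))) - C (Rn n) - (Sn n).map C - X * (Sn n).map C
      + C (C ((c 0 0 n : ℕ) : ℚ)) := by
  ext j i
  have key := fun (i j : ℕ) => c_succ (i : ℤ) (j : ℤ) (by positivity) (by positivity) n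
  rcases j with _ | _ | j
  · rcases i with _ | i <;>
    simp [Qn_coeff, Rn_coeff, Sn_coeff, coeff_C, mul_coeff_zero]
  · rcases i with _ | _ | i
    · simp [Qn_coeff, Rn_coeff, Sn_coeff, coeff_C, mul_coeff_zero]
    · have := key 0 0
      simp [Qn_coeff, Rn_coeff, Sn_coeff, coeff_C, mul_coeff_zero] at this ⊢
      rw [this]
      simp [c_neg]
      ring
    · have := key (i+1) 0
      simp [Qn_coeff, Rn_coeff, Sn_coeff, coeff_C, mul_coeff_zero] at this ⊢
      rw [this]
      simp [c_neg]
      ring_nf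
  · rcases i with _ | _ | i
    · simp [Qn_coeff, Rn_coeff, Sn_coeff, coeff_C, mul_coeff_zero]
    · have := key 0 (j+1)
      simp [Qn_coeff, Rn_coeff, Sn_coeff, coeff_C, mul_coeff_zero] at this ⊢
      rw [this]
      simp [c_neg]
      ring_nf
    · have := key (i+1) (j+1)
      simp [Qn_coeff, Rn_coeff, Sn_coeff, coeff_C, mul_coeff_zero] at this ⊢
      rw [this]
      simp
      ring_nf

end Gessel

namespace Gessel

open Polynomial

/-- Series in `t` with coefficients in `ℚ[x]` (or in `ℚ[y]`). -/
abbrev PX := PowerSeries ℚ[X]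

/-- Series in `t` with coefficients in `ℚ[x][y]`. -/
abbrev PW := PowerSeries ℚ[X][X]

noncomputable def ιx : PX →+* PW := PowerSeries.map (C : ℚ[X] →+* ℚ[X][X])
noncomputable def ιy : PX →+* PW := PowerSeries.map (mapRingHom (C : ℚ →+* ℚ[X]))
noncomputable def ι0 : PowerSeries ℚ →+* PX := PowerSeries.map (C : ℚ →+* ℚ[X])
noncomputable def ex0 : PW →+* PX := PowerSeries.map (mapRingHom (evalRingHom (0 : ℚ)))
noncomputable def ey0 : PW →+* PX := PowerSeries.map (evalRingHom (0 : ℚ[X]))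
noncomputable def ev (a : ℚ) : PX →+* PowerSeries ℚ := PowerSeries.map (evalRingHom a)

noncomputable def xv : PX := PowerSeries.C X
noncomputable def tX : PX := PowerSeries.X
noncomputable def xW : PW := PowerSeries.C (C X)
noncomputable def yW : PW := PowerSeries.C X
noncomputable def tW : PW := PowerSeries.X

noncomputable def LW : PW := xW * yW - tW * ((1 + yW) * (1 + xW ^ 2 * yW))

noncomputable def Qs : PW := PowerSeries.mk Qn
noncomputable def Rs : PX := PowerSeries.mk Rn
noncomputable def Ss : PX := PowerSeries.mk Sn
noncomputable def Zs : PowerSeries ℚ := PowerSeries.mk fun n => ((c 0 0 n : ℕ) : ℚ)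

lemma ιx_xv : ιx xv = xW := by simp [ιx, xv, xW]
lemma ιy_xv : ιy xv = yW := by simp [ιy, xv, yW]
lemma ιx_tX : ιx tX = tW := by simp [ιx, tX, tW]
lemma ιy_tX : ιy tX = tW := by simp [ιy, tX, tW]
lemma ιy_ι0 (z : PowerSeries ℚ) : ιy (ι0 z) = ιx (ι0 z) := by
  ext n : 1; simp [ιx, ιy, ι0]
lemma ι0_X : ι0 PowerSeries.X = tX := by simp [ι0, tX]
lemma ey0_ιx (f : PX) : ey0 (ιx f) = f := by ext n : 1; simp [ey0, ιx]
lemma ex0_ιy (f : PX) : ex0 (ιy f) = f := by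
  ext n : 1
  have : (evalRingHom (0 : ℚ)).comp C = RingHom.id ℚ := by ext; simp
  simp [ex0, ιy, Polynomial.map_map, this]
lemma ey0_ιy (f : PX) : ey0 (ιy f) = ι0 (ev 0 f) := by
  ext n : 1
  simp [ey0, ιy, ι0, ev, Polynomial.eval_map, Polynomial.eval₂_zero, Polynomial.coeff_zero_eq_eval_zero]
lemma ey0_yW : ey0 yW = 0 := by simp [ey0, yW]
lemma ey0_xW : ey0 xW = xv := by simp [ey0, xW, xv]
lemma ex0_xW : ex0 xW = 0 := by simp [ex0, xW]
lemma ex0_yW : ex0 yW = xv := by simp [ex0, yW, xv]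
lemma ex0_tW : ex0 tW = tX := by simp [ex0, tW, tX]
lemma ev_xv (a : ℚ) : ev a xv = PowerSeries.C a := by simp [ev, xv]
lemma ev_tX (a : ℚ) : ev a tX = PowerSeries.X := by simp [ev, tX]
lemma ev_ι0 (a : ℚ) (z : PowerSeries ℚ) : ev a (ι0 z) = z := by ext n; simp [ev, ι0]
lemma ι0_inj : Function.Injective ι0 := fun a b h => by
  rw [← ev_ι0 0 a, h, ev_ι0]
lemma ιx_inj : Function.Injective ιx := fun a b h => by
  rw [← ey0_ιx a, h, ey0_ιx]
lemma ιy_inj : Function.Injective ιy := fun a b h => by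
  rw [← ex0_ιy a, h, ex0_ιy]

/-- The functional equation. -/
lemma funeq : LW * Qs = xW * yW - tW * ιx Rs - tW * (1 + yW) * ιy Ss + tW * ιx (ι0 Zs) := by
  have h : LW * Qs = yW * (xW * Qs) - tW * (Qs + yW * Qs + xW * (xW * (yW * Qs)) +
      xW * (xW * (yW * (yW * Qs)))) := by
    rw [LW]; ring
  have h2 : xW * yW - tW * ιx Rs - tW * (1 + yW) * ιy Ss + tW * ιx (ι0 Zs) =
    PowerSeries.C (C X * X) - tW * (ιx Rs + ιy Ss + yW * ιy Ss - ιx (ι0 Zs)) := by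
    rw [map_mul]; simp only [xW, yW]; ring
  rw [h, h2]
  refine PowerSeries.ext fun n => ?_
  rcases n with _ | n
  · simp only [xW, yW, tW, Qs, map_sub, PowerSeries.coeff_C_mul, PowerSeries.coeff_zero_X_mul,
      PowerSeries.coeff_mk, Qn_zero, PowerSeries.coeff_zero_C]
    ring
  · have := Qn_rec n
    simp only [xW, yW, tW, Qs, ιx, ιy, ι0, Rs, Ss, Zs, map_sub, map_add,
      PowerSeries.coeff_C_mul, PowerSeries.coeff_succ_X_mul, PowerSeries.coeff_mk,
      PowerSeries.coeff_map, PowerSeries.coeff_C, mapRingHom, coe_mapRingHom]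
    rw [this]
    simp
    ring

lemma exists_dec (f : PX) : ∃ g : PX, f = ι0 (ev 0 f) + xv * g := by
  refine ⟨PowerSeries.mk fun n => divX (PowerSeries.coeff n f), ?_⟩
  refine PowerSeries.ext fun n => ?_
  have := X_mul_divX_add (PowerSeries.coeff n f)
  simp only [ι0, ev, xv, map_add, PowerSeries.coeff_map, PowerSeries.coeff_C_mul,
    PowerSeries.coeff_mk]
  conv_lhs => rw [← this]
  simp [coeff_zero_eq_eval_zero, add_comm]

lemma ev0_Rs : ev 0 Rs = Zs := by
  ext n
  simp [ev, Rs, Zs, ← coeff_zero_eq_eval_zero, Rn_coeff]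

lemma ev0_Ss : ev 0 Ss = Zs := by
  ext n
  simp [ev, Ss, Zs, ← coeff_zero_eq_eval_zero, Sn_coeff]

lemma poly_lemma (a b : ℚ[X]) (h : ℚ[X][X])
    (e : C a * (1 + X) ^ 3 - b.map C = X * (C X * h)) : h = 0 := by
  have e1 := congrArg (eval 0) e
  have e2 := congrArg (map (evalRingHom (0 : ℚ))) e
  simp [eval_map, eval₂_zero] at e1
  simp [Polynomial.map_map, evalRingHom] at e2
  have e3 : b = C (a.eval 0) * (1 + X) ^ 3 := by
    rw [← coeff_zero_eq_eval_zero]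
    have h0 : map ((evalRingHom (0 : ℚ)).comp C) b = b := by
      have : (evalRingHom (0 : ℚ)).comp C = RingHom.id ℚ := by ext; simp
      rw [this, map_id]
    linear_combination -e2
  have e4 : a = C (a.eval 0) := by
    have : b.coeff 0 = a.eval 0 := by
      rw [e3]; simp [coeff_zero_eq_eval_zero]
    rw [this] at e1
    linear_combination e1
  have e5 : b.map C = C a * (1 + X) ^ 3 := by
    rw [e3]
    simp only [Polynomial.map_mul, map_C, Polynomial.map_pow, Polynomial.map_add,
      Polynomial.map_one, map_X]
    rw [← e4]
  rw [e5, sub_self] at e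
  have := e.symm
  simpa using this

/-- The invariant lemma. -/
lemma inv_lemma (A B : PX) (H : PW) (h : ιx A * (1 + yW) ^ 3 - ιy B = LW * H) : H = 0 := by
  have key : ∀ n, PowerSeries.coeff n H = 0 := by
    intro n
    induction n using Nat.strong_induction_on with
    | _ n ih =>
      have h1 : LW * H = yW * (xW * H) - tW * (PowerSeries.C ((1 + X) * (1 + (C X) ^ 2 * X)) * H) := by
        simp only [map_mul, map_add, map_pow, map_one]
        rw [LW]; simp only [xW, yW]; ring
      have h2 : (1 + yW) ^ 3 = PowerSeries.C ((1 + X) ^ 3) := by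
        simp [yW]
      rw [h1, h2] at h
      have h3 := congrArg (PowerSeries.coeff n) h
      apply poly_lemma (PowerSeries.coeff n A) (PowerSeries.coeff n B)
      rcases n with _ | n
      · simp only [xW, yW, tW, ιx, ιy, map_sub, PowerSeries.coeff_mul_C,
          PowerSeries.coeff_C_mul, PowerSeries.coeff_zero_X_mul, PowerSeries.coeff_map,
          sub_zero, coe_mapRingHom] at h3
        exact h3
      · have := ih n (by omega)
        simp only [xW, yW, tW, ιx, ιy, map_sub, PowerSeries.coeff_mul_C,
          PowerSeries.coeff_C_mul, PowerSeries.coeff_succ_X_mul, PowerSeries.coeff_map, this,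
          mul_zero, sub_zero, coe_mapRingHom] at h3
        exact h3
  exact PowerSeries.ext fun n => by simpa using key n

lemma xW_dvd (f : PW) (h : ex0 f = 0) : xW ∣ f := by
  have : ∀ n, (C X : ℚ[X][X]) ∣ PowerSeries.coeff n f := by
    intro n
    rw [C_dvd_iff_dvd_coeff]
    intro i
    have := congrArg (PowerSeries.coeff n) h
    simp only [ex0, PowerSeries.coeff_map, map_zero] at this
    have := congrArg (fun p => Polynomial.coeff p i) this
    simp only [coe_mapRingHom, coeff_map, coeff_zero, coe_evalRingHom] at this
    rw [X_dvd_iff, coeff_zero_eq_eval_zero, this]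
  choose g hg using this
  refine ⟨PowerSeries.mk g, PowerSeries.ext fun n => ?_⟩
  simp [xW, hg n]

lemma xv_ne : xv ≠ 0 := by
  intro h
  have := congrArg (PowerSeries.coeff 0) h
  simp [xv] at this

lemma xW_ne : xW ≠ 0 := by
  rw [← ιx_xv]; exact fun h => xv_ne (ιx_inj (by simpa using h))

lemma xW_prime : Prime xW := by
  refine ⟨xW_ne, ?_, ?_⟩
  · intro h
    have := h.map ex0
    rw [ex0_xW] at this
    simp at this
  · intro a b h
    obtain ⟨d, hd⟩ := h
    have := congrArg ex0 hd
    rw [map_mul, map_mul, ex0_xW, zero_mul, mul_eq_zero] at this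
    exact this.imp (xW_dvd a) (xW_dvd b)

lemma xW_not_dvd : ¬ xW ∣ LW := by
  rintro ⟨d, hd⟩
  have := congrArg ex0 hd
  simp only [LW, map_mul, map_sub, map_add, map_pow, ex0_xW, ex0_yW, ex0_tW, map_one] at this
  have := congrArg (fun f => PowerSeries.coeff 1 f) this
  simp only [zero_mul, zero_sub, map_neg, tX, xv] at this
  rw [show (1 : ℕ) = 0 + 1 from rfl, PowerSeries.coeff_succ_X_mul] at this
  simp at this
  have := congrArg (eval 0) this
  simp at this

/-- Pure algebra: the difference of the two invariants is a multiple of the kernel. -/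
lemma alg_id {K : Type*} [CommRing K] (x y t Q Z r1 r2 R3 S1 R S u g h v v1 ρ0 ρ1 β L A B : K)
    (hL : L = x * y - t * ((1 + y) * (1 + x ^ 2 * y)))
    (hR : R = Z + x * (r1 + x * (r2 + x * R3))) (hS : S = Z + y * S1)
    (hρ0 : ρ0 = t * Z) (hρ1 : ρ1 = t * r1) (hβ : β = 2 * t - ρ0 - 2 * t * ρ1)
    (hh : h = t * r2 + x * t * R3) (hg : g = ρ1 + x * h)
    (hu : u = 1 + x ^ 2 * g)
    (hv : v = y - t ^ 2 * (1 + y) ^ 2 * S)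
    (hv1 : v1 = 1 - t ^ 2 * (1 + y) * (S + S1))
    (hA : A = 2 * t * h + 1 - 2 * t * ρ0 + g + 2 * (t * ρ0 - 1) * g
      + x * (-t + ρ0 - 2 * t * g + 3 * t * g ^ 2 + β * g)
      + x ^ 2 * (-t * ρ0 + g + (t * ρ0 - 1) * g ^ 2) + x ^ 3 * (-t * g + t * g ^ 3))
    (hB : B = v1 * (t ^ 2 * (1 - y ^ 2) ^ 2 + y ^ 2) + v ^ 3 + (t * ρ0 - 1) * (1 + y) * v ^ 2
      + t * β * (1 + y) ^ 2 * v)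
    (fe : L * Q = x * y - t * R - t * (1 + y) * S + t * Z) :
    x ^ 3 * A = (u + x * ρ0) * (x * (x ^ 2 + 1) - t * (x ^ 2 + 1) ^ 2) + t * u ^ 3
      + (t * ρ0 - 1) * x * u ^ 2 + β * x ^ 2 * u ∧
    y * v1 = v + (1 + y) * t * ρ0 ∧
    u = 1 + x * t * (R - Z) ∧
    ∃ N, x ^ 3 * (t ^ 2 * A * (1 + y) ^ 3 - B) = L * N := by
  have e1 : x ^ 3 * A = (u + x * ρ0) * (x * (x ^ 2 + 1) - t * (x ^ 2 + 1) ^ 2) + t * u ^ 3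
      + (t * ρ0 - 1) * x * u ^ 2 + β * x ^ 2 * u := by
    subst hA hu hβ
    have : x ^ 3 * (2 * t * h) = x ^ 2 * (2 * t * (g - ρ1)) := by rw [hg]; ring
    linear_combination this
  have e2 : y * v1 = v + (1 + y) * t * ρ0 := by
    subst hv1 hv hρ0 hS; ring
  have e3 : u = 1 + x * t * (R - Z) := by
    subst hu hg hh hρ1 hR; ring
  refine ⟨e1, e2, e3, ?_⟩
  have e4 : t * (1 + y) * u - x * v = - L * (x * t * (1 + y) * Q + 1) := by
    have : L * (x * t * (1 + y) * Q + 1) = x * t * (1 + y) * (L * Q) + L := by ring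
    rw [e3, hv, neg_mul, this, fe, hL]; ring
  have e5 : y * (1 + y) ^ 2 * (t * x * (x ^ 2 + 1) - t ^ 2 * (x ^ 2 + 1) ^ 2)
      - x ^ 2 * (t ^ 2 * (1 - y ^ 2) ^ 2 + y ^ 2) = L * (- x * y + t * (1 + y) * (x ^ 2 + y)) := by
    rw [hL]; ring
  clear hL hR hS hρ0 hρ1 hβ hh hg hu hv hv1 hA fe e3
  refine ⟨-(x * t * (1 + y) * Q + 1) * (t * (1 + y) ^ 2 * (x * (x ^ 2 + 1) - t * (x ^ 2 + 1) ^ 2)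
    + t ^ 2 * (1 + y) ^ 2 * u ^ 2 + t * (1 + y) * x * u * v + x ^ 2 * v ^ 2
    + (t * ρ0 - 1) * (t * (1 + y) ^ 2 * x * u + (1 + y) * x ^ 2 * v)
    + t * β * (1 + y) ^ 2 * x ^ 2) + x * (- x * y + t * (1 + y) * (x ^ 2 + y)) * v1, ?_⟩
  subst hB
  linear_combination (t ^ 2 * (1 + y) ^ 3) * e1 + (t * (1 + y) ^ 2 * (x * (x ^ 2 + 1) - t * (x ^ 2 + 1) ^ 2)
    + t ^ 2 * (1 + y) ^ 2 * u ^ 2 + t * (1 + y) * x * u * v + x ^ 2 * v ^ 2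
    + (t * ρ0 - 1) * (t * (1 + y) ^ 2 * x * u + (1 + y) * x ^ 2 * v)
    + t * β * (1 + y) ^ 2 * x ^ 2) * e4 + x * v1 * e5 
    - (t * x * (1 + y) ^ 2 * (x * (x ^ 2 + 1) - t * (x ^ 2 + 1) ^ 2)) * e2

end Gessel

namespace Gessel

open Polynomial

noncomputable def uX : PX := 1 + xv * tX * (Rs - ι0 Zs)
noncomputable def vX : PX := xv - tX ^ 2 * (1 + xv) ^ 2 * Ss

lemma main_cubic : ∃ r1 δ : PowerSeries ℚ,
    tX ^ 2 * ((uX + xv * (tX * ι0 Zs)) * (xv * (xv ^ 2 + 1) - tX * (xv ^ 2 + 1) ^ 2) + tX * uX ^ 3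
      + (tX * (tX * ι0 Zs) - 1) * xv * uX ^ 2
      + (2 * tX - tX * ι0 Zs - 2 * tX * (tX * ι0 r1)) * xv ^ 2 * uX) = xv ^ 3 * ι0 δ ∧
    (vX + (1 + xv) * tX * (tX * ι0 Zs)) * (tX ^ 2 * (1 - xv ^ 2) ^ 2 + xv ^ 2)
      + xv * (vX ^ 3 + (tX * (tX * ι0 Zs) - 1) * (1 + xv) * vX ^ 2
      + tX * (2 * tX - tX * ι0 Zs - 2 * tX * (tX * ι0 r1)) * (1 + xv) ^ 2 * vX)
      = xv * (1 + xv) ^ 3 * ι0 δ := by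
  obtain ⟨R1, hR1⟩ := exists_dec Rs
  obtain ⟨R2, hR2⟩ := exists_dec R1
  obtain ⟨R3, hR3⟩ := exists_dec R2
  obtain ⟨S1, hS1⟩ := exists_dec Ss
  rw [ev0_Rs] at hR1
  rw [ev0_Ss] at hS1
  set r1 := ev 0 R1
  set r2 := ev 0 R2
  obtain ⟨ρ0, hρ0⟩ : ∃ z, z = tX * ι0 Zs := ⟨_, rfl⟩
  obtain ⟨ρ1, hρ1⟩ : ∃ z, z = tX * ι0 r1 := ⟨_, rfl⟩
  obtain ⟨β, hβ⟩ : ∃ z, z = 2 * tX - ρ0 - 2 * tX * ρ1 := ⟨_, rfl⟩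
  obtain ⟨h, hh⟩ : ∃ z, z = tX * ι0 r2 + xv * tX * R3 := ⟨_, rfl⟩
  obtain ⟨g, hg⟩ : ∃ z, z = ρ1 + xv * h := ⟨_, rfl⟩
  obtain ⟨v1, hv1⟩ : ∃ z, z = 1 - tX ^ 2 * (1 + xv) * (Ss + S1) := ⟨_, rfl⟩
  obtain ⟨A, hA⟩ : ∃ z, z = 2 * tX * h + 1 - 2 * tX * ρ0 + g + 2 * (tX * ρ0 - 1) * g
      + xv * (-tX + ρ0 - 2 * tX * g + 3 * tX * g ^ 2 + β * g)
      + xv ^ 2 * (-tX * ρ0 + g + (tX * ρ0 - 1) * g ^ 2) + xv ^ 3 * (-tX * g + tX * g ^ 3) :=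
    ⟨_, rfl⟩
  obtain ⟨B, hB⟩ : ∃ z, z = v1 * (tX ^ 2 * (1 - xv ^ 2) ^ 2 + xv ^ 2) + vX ^ 3
      + (tX * ρ0 - 1) * (1 + xv) * vX ^ 2 + tX * β * (1 + xv) ^ 2 * vX := ⟨_, rfl⟩
  have hR : Rs = ι0 Zs + xv * (ι0 r1 + xv * (ι0 r2 + xv * R3)) := by
    rw [← hR3, ← hR2, ← hR1]
  have hu : uX = 1 + xv ^ 2 * g := by
    rw [uX, hR, hg, hh, hρ1]; ring
  have hyρ0 : ιy ρ0 = ιx ρ0 := by rw [hρ0]; simp [ιy_ι0, ιy_tX, ιx_tX]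
  have hyρ1 : ιy ρ1 = ιx ρ1 := by rw [hρ1]; simp [ιy_ι0, ιy_tX, ιx_tX]
  have hyβ : ιy β = ιx β := by rw [hβ]; simp only [map_sub, map_mul, map_ofNat, ιy_tX, ιx_tX, hyρ0, hyρ1]
  obtain ⟨e1, e2, -, N, hN⟩ := alg_id xW yW tW Qs (ιx (ι0 Zs)) (ιx (ι0 r1)) (ιx (ι0 r2)) (ιx R3)
    (ιy S1) (ιx Rs) (ιy Ss) (ιx uX) (ιx g) (ιx h) (ιy vX) (ιy v1) (ιx ρ0) (ιx ρ1) (ιx β) LW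
    (ιx A) (ιy B) rfl (by rw [hR]; simp [ιx_xv]) (by rw [hS1]; simp [ιy_xv, ιy_ι0])
    (by rw [hρ0]; simp [ιx_tX]) (by rw [hρ1]; simp [ιx_tX]) (by rw [hβ]; simp only [map_sub, map_mul, map_ofNat, ιx_tX])
    (by rw [hh]; simp [ιx_tX, ιx_xv]) (by rw [hg]; simp [ιx_xv])
    (by rw [hu]; simp [ιx_xv]) (by simp [vX, ιy_xv, ιy_tX])
    (by rw [hv1]; simp [ιy_xv, ιy_tX])
    (by rw [hA]; simp only [map_add, map_sub, map_mul, map_pow, map_neg, map_one, map_ofNat,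
      ιx_xv, ιx_tX])
    (by rw [hB]; simp only [map_add, map_sub, map_mul, map_pow, map_neg, map_one, map_ofNat,
      ιy_xv, ιy_tX, hyβ, hyρ0]) funeq
  have hdiv : xW ^ 3 ∣ N :=
    xW_prime.pow_dvd_of_dvd_mul_left 3 xW_not_dvd ⟨_, hN.symm⟩
  obtain ⟨H, rfl⟩ := hdiv
  have hH : ιx (tX ^ 2 * A) * (1 + yW) ^ 3 - ιy B = LW * H := by
    apply mul_left_cancel₀ (pow_ne_zero 3 xW_ne)
    rw [map_mul, map_pow, ιx_tX, hN]; ring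
  have hH0 := inv_lemma _ _ _ hH
  rw [hH0, mul_zero] at hH
  have hA' : tX ^ 2 * A = ι0 (ev 0 B) := by
    have := congrArg ey0 hH
    simp only [map_sub, map_mul (f := ey0), map_pow (f := ey0), map_add (f := ey0),
      map_one (f := ey0), ey0_ιx, ey0_ιy, ey0_yW, map_zero] at this
    linear_combination this
  have hB' : B = (1 + xv) ^ 3 * ι0 (ev 0 B) := by
    apply ιy_inj
    rw [hA'] at hH
    simp only [map_mul (f := ιy), map_pow (f := ιy), map_add (f := ιy), map_one (f := ιy), ιy_xv,
      ιy_ι0]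
    linear_combination -hH
  refine ⟨r1, ev 0 B, ?_, ?_⟩
  · rw [← hρ0, ← hρ1, ← hβ, ← hA']
    have : xv ^ 3 * A = (uX + xv * ρ0) * (xv * (xv ^ 2 + 1) - tX * (xv ^ 2 + 1) ^ 2)
      + tX * uX ^ 3 + (tX * ρ0 - 1) * xv * uX ^ 2 + β * xv ^ 2 * uX := by
      apply ιx_inj
      simp only [map_add, map_sub, map_mul, map_pow, map_one, ιx_xv, ιx_tX]
      exact e1
    linear_combination -tX ^ 2 * this
  · rw [← hρ0, ← hρ1, ← hβ]
    have : xv * v1 = vX + (1 + xv) * tX * ρ0 := by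
      apply ιy_inj
      simp only [map_add, map_mul, map_one, ιy_xv, ιy_tX, hyρ0]
      exact e2
    rw [← this]
    linear_combination xv * hB' - xv * hB

/-- Coefficientwise derivative. -/
noncomputable def D : Derivation ℚ PX PX :=
  Derivation.mk' { toFun := fun f => PowerSeries.mk fun n => derivative (PowerSeries.coeff n f)
                   map_add' := by intro f g; ext n : 1; simp
                   map_smul' := by intro a f; ext n : 1; simp } (by
    intro f g
    ext n : 1
    simp only [LinearMap.coe_mk, AddHom.coe_mk, smul_eq_mul, map_add, PowerSeries.coeff_mul,
      PowerSeries.coeff_mk, derivative_sum, derivative_mul, Finset.sum_add_distrib]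
    rw [add_comm]
    congr 1
    rw [← Finset.Nat.sum_antidiagonal_swap]
    exact Finset.sum_congr rfl fun p _ => by simp [mul_comm])

lemma D_coeff (f : PX) (n : ℕ) :
    PowerSeries.coeff n (D f) = derivative (PowerSeries.coeff n f) := by
  change PowerSeries.coeff n (PowerSeries.mk fun n => derivative (PowerSeries.coeff n f)) = _
  simp

lemma D_ι0 (z : PowerSeries ℚ) : D (ι0 z) = 0 := by
  ext n : 1
  rw [D_coeff]; simp [ι0]

lemma D_tX : D tX = 0 := by rw [← ι0_X, D_ι0]

lemma D_xv : D xv = 1 := by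
  ext n : 1
  rw [D_coeff, xv, PowerSeries.coeff_C, PowerSeries.coeff_one]; split_ifs <;> simp

/-- Double root at `x = 1`. -/
lemma pt1 (r1 δ : PowerSeries ℚ) (Z t : PowerSeries ℚ) (ht : t = PowerSeries.X) (hZ : Z = Zs)
    (e : tX ^ 2 * ((uX + xv * (tX * ι0 Zs)) * (xv * (xv ^ 2 + 1) - tX * (xv ^ 2 + 1) ^ 2)
      + tX * uX ^ 3 + (tX * (tX * ι0 Zs) - 1) * xv * uX ^ 2
      + (2 * tX - tX * ι0 Zs - 2 * tX * (tX * ι0 r1)) * xv ^ 2 * uX) = xv ^ 3 * ι0 δ)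
    (a : ℚ) (ha : a ^ 2 = 1) :
    ∃ p : PowerSeries ℚ, t ^ 2 * ((p + t * Z) * (2 * PowerSeries.C a - 4 * t) + t * p ^ 3
      + (t * (t * Z) - 1) * p ^ 2 + (2 * t - t * Z - 2 * t * (t * r1)) * p) = δ ∧
      (2 * PowerSeries.C a - 4 * t) + 3 * t * p ^ 2 + 2 * (t * (t * Z) - 1) * p
      + (2 * t - t * Z - 2 * t * (t * r1)) = 0 := by
  have hC : (PowerSeries.C a : PowerSeries ℚ) ^ 2 = 1 := by rw [← map_pow, ha, map_one]
  have e' := congrArg (fun f => ev a (D f)) e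
  have e0 := congrArg (ev a) e
  have hnum : ∀ k : ℕ, D (k : PX) = 0 := fun k => D.map_natCast k
  have h2 : D (2 : PX) = 0 := hnum 2
  simp only [D.leibniz, D.leibniz_pow, map_add, map_sub, D_tX, D_xv, D_ι0, D.map_one_eq_zero,
    smul_eq_mul, map_mul, map_pow, map_one, map_zero, ev_xv, ev_tX, ev_ι0, map_nsmul,
    nsmul_eq_mul, map_natCast, h2, map_ofNat, ← ht, ← hZ] at e' e0
  have hc1 : PowerSeries.coeff 0 uX = 1 := by
    rw [uX, mul_assoc, mul_left_comm, tX]; simp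
  have hP : PowerSeries.coeff 0 (ev a uX) = 1 := by
    rw [ev, PowerSeries.coeff_map, hc1]; simp
  have hP' : PowerSeries.coeff 0 (ev a (D uX)) = 0 := by
    rw [ev, PowerSeries.coeff_map, D_coeff, hc1]; simp
  generalize ev a uX = P at *
  generalize ev a (D uX) = P' at *
  have ht0 : t ≠ 0 := by rw [ht]; exact PowerSeries.X_ne_zero
  push_cast at e'
  have ha' : (a - 1) * (a + 1) = 0 := by linear_combination ha
  obtain rfl | rfl : a = 1 ∨ a = -1 := by
    rcases mul_eq_zero.1 ha' with h | h
    · left; linarith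
    · right; linarith
  · rw [map_one] at e' e0 ⊢
    refine ⟨P, by linear_combination e0, ?_⟩
    have hne : P' - P ≠ 0 := by
      intro h
      have := congrArg (PowerSeries.coeff 0) h
      rw [map_sub, hP, hP'] at this
      simp at this
    apply mul_left_cancel₀ (mul_ne_zero (pow_ne_zero 2 ht0) hne)
    linear_combination e' - 3 * e0
  · rw [map_neg, map_one] at e' e0 ⊢
    refine ⟨-P, by linear_combination -e0, ?_⟩
    have hne : -P' - P ≠ 0 := by
      intro h
      have := congrArg (PowerSeries.coeff 0) h
      rw [map_sub, map_neg, hP, hP'] at this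
      simp at this
    apply mul_left_cancel₀ (mul_ne_zero (pow_ne_zero 2 ht0) hne)
    linear_combination -e' - 3 * e0

/-- Double root at `y = 1`. -/
lemma pt2 (r1 δ : PowerSeries ℚ) (Z t : PowerSeries ℚ) (ht : t = PowerSeries.X) (hZ : Z = Zs)
    (e : (vX + (1 + xv) * tX * (tX * ι0 Zs)) * (tX ^ 2 * (1 - xv ^ 2) ^ 2 + xv ^ 2)
      + xv * (vX ^ 3 + (tX * (tX * ι0 Zs) - 1) * (1 + xv) * vX ^ 2
      + tX * (2 * tX - tX * ι0 Zs - 2 * tX * (tX * ι0 r1)) * (1 + xv) ^ 2 * vX)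
      = xv * (1 + xv) ^ 3 * ι0 δ) :
    ∃ p : PowerSeries ℚ, p + 2 * t * (t * Z) + p ^ 3
      + 2 * (t * (t * Z) - 1) * p ^ 2 + 4 * t * (2 * t - t * Z - 2 * t * (t * r1)) * p = 8 * δ ∧
      1 + 3 * p ^ 2 + 4 * (t * (t * Z) - 1) * p
      + 4 * t * (2 * t - t * Z - 2 * t * (t * r1)) = 0 := by
  have e' := congrArg (fun f => ev 1 (D f)) e
  have e0 := congrArg (ev 1) e
  have hnum : ∀ k : ℕ, D (k : PX) = 0 := fun k => D.map_natCast k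
  have h2 : D (2 : PX) = 0 := hnum 2
  simp only [D.leibniz, D.leibniz_pow, map_add, map_sub, D_tX, D_xv, D_ι0, D.map_one_eq_zero,
    smul_eq_mul, map_mul, map_pow, map_one, map_zero, ev_xv, ev_tX, ev_ι0, map_nsmul,
    nsmul_eq_mul, map_natCast, h2, map_ofNat, ← ht, ← hZ] at e' e0
  have hc1 : PowerSeries.coeff 0 vX = X := by
    rw [vX, pow_two, mul_assoc, mul_assoc, tX, xv]; simp
  have hP : PowerSeries.coeff 0 (ev 1 vX) = 1 := by
    rw [ev, PowerSeries.coeff_map, hc1]; simp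
  have hP' : PowerSeries.coeff 0 (ev 1 (D vX)) = 1 := by
    rw [ev, PowerSeries.coeff_map, D_coeff, hc1]; simp
  generalize ev 1 vX = P at *
  generalize ev 1 (D vX) = P' at *
  push_cast at e'
  refine ⟨P, by linear_combination e0, ?_⟩
  have hne : 2 * P' - P ≠ 0 := by
    intro h
    have := congrArg (PowerSeries.coeff 0) h
    rw [map_sub, hP, two_mul, map_add, hP'] at this
    simp at this
  apply mul_left_cancel₀ hne
  linear_combination 2 * e' - 5 * e0

end Gessel

namespace Gessel

open Polynomial

/-- Three distinct roots of a cubic determine its coefficients. -/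
lemma vieta3 {F : Type*} [Field F] (V1 V2 V3 a b c : F) (h12 : V1 - V2 ≠ 0) (h13 : V1 - V3 ≠ 0)
    (h23 : V2 - V3 ≠ 0) (h1 : -4 * V1 ^ 3 + a * V1 ^ 2 + b * V1 + c = 0)
    (h2 : -4 * V2 ^ 3 + a * V2 ^ 2 + b * V2 + c = 0)
    (h3 : -4 * V3 ^ 3 + a * V3 ^ 2 + b * V3 + c = 0) :
    a = 4 * (V1 + V2 + V3) ∧ b = -4 * (V1 * V2 + V1 * V3 + V2 * V3) ∧ c = 4 * (V1 * V2 * V3) := by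
  have g1 : -4 * (V1 ^ 2 + V1 * V2 + V2 ^ 2) + a * (V1 + V2) + b = 0 := by
    apply mul_left_cancel₀ h12; linear_combination h1 - h2
  have g2 : -4 * (V1 ^ 2 + V1 * V3 + V3 ^ 2) + a * (V1 + V3) + b = 0 := by
    apply mul_left_cancel₀ h13; linear_combination h1 - h3
  have ha : a = 4 * (V1 + V2 + V3) := by
    apply mul_left_cancel₀ h23; linear_combination g1 - g2
  have hb : b = -4 * (V1 * V2 + V1 * V3 + V2 * V3) := by
    rw [ha] at g1; linear_combination g1
  refine ⟨ha, hb, ?_⟩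
  rw [ha, hb] at h1; linear_combination h1

lemma disc3 {F : Type*} [Field F] (r0 a b d V j : F)
    (h : j ^ 3 + a * j ^ 2 + b * j + (j + r0) * V = d)
    (h' : 3 * j ^ 2 + 2 * a * j + b + V = 0) :
    -4 * V ^ 3 + (18 * a * r0 + a ^ 2 - 12 * b - 27 * r0 ^ 2) * V ^ 2
    + (18 * a * (b * r0 - d) - 4 * a ^ 3 * r0 + 2 * a ^ 2 * b - 12 * b ^ 2 + 54 * r0 * d) * V
    + (-18 * a * b * d + 4 * a ^ 3 * d + a ^ 2 * b ^ 2 - 4 * b ^ 3 - 27 * d ^ 2) = 0 := by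
  obtain rfl : b = -3 * j ^ 2 - 2 * a * j - V := by linear_combination h'
  subst h
  ring

/-- The equations for `r0`, `r1`, `d` that follow from the three double roots. -/
lemma solve {F : Type*} [Field F] [CharZero F] (t s r0 r1 d j1 j2 j3 : F) (hs : s * t = 1)
    (n1 : 1 - 4 * t ≠ 0) (n2 : 1 + 4 * t ≠ 0) (a b : F) (ha : a = r0 - s)
    (hb : b = 2 - r0 * s - 2 * r1)
    (h1 : j1 ^ 3 + a * j1 ^ 2 + b * j1 + (j1 + r0) * (2 * s - 4) = d)
    (h1' : 3 * j1 ^ 2 + 2 * a * j1 + b + (2 * s - 4) = 0)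
    (h2 : j2 ^ 3 + a * j2 ^ 2 + b * j2 + (j2 + r0) * (-2 * s - 4) = d)
    (h2' : 3 * j2 ^ 2 + 2 * a * j2 + b + (-2 * s - 4) = 0)
    (h3 : j3 ^ 3 + a * j3 ^ 2 + b * j3 + (j3 + r0) * (s ^ 2 / 4) = d)
    (h3' : 3 * j3 ^ 2 + 2 * a * j3 + b + (s ^ 2 / 4) = 0) :
    3 * r1 = r0 ^ 2 + r0 * s - 1 ∧
    d * (36 * r0 + 18 * s) = -64 + 24 * s ^ 2 - 18 * a * b * r0 + 4 * a ^ 3 * r0 - 2 * a ^ 2 * b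
      + 12 * b ^ 2 ∧
    -18 * a * b * d + 4 * a ^ 3 * d + a ^ 2 * b ^ 2 - 4 * b ^ 3 - 27 * d ^ 2
      = s ^ 2 * (16 - 4 * s ^ 2) := by
  have hs0 : s ≠ 0 := left_ne_zero_of_mul_eq_one hs
  have n3 : 1 - 4 * t ≠ 0 := n1
  have m1 : s - 4 ≠ 0 := by
    intro h; apply n1; linear_combination t * h - hs
  have m2 : s + 4 ≠ 0 := by
    intro h; apply n2; linear_combination t * h - hs
  obtain ⟨e1, e2, e3⟩ := vieta3 (2 * s - 4) (-2 * s - 4) (s ^ 2 / 4) _ _ _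
    (by intro h; apply hs0; linear_combination h / 4)
    (by
      intro h
      have : (s - 4) * (s - 4) = 0 := by linear_combination -4 * h
      rcases mul_eq_zero.1 this with h | h <;> exact m1 h)
    (by
      intro h
      have : (s + 4) * (s + 4) = 0 := by linear_combination -4 * h
      rcases mul_eq_zero.1 this with h | h <;> exact m2 h)
    (disc3 r0 a b d _ j1 h1 h1') (disc3 r0 a b d _ j2 h2 h2') (disc3 r0 a b d _ j3 h3 h3')
  refine ⟨?_, ?_, ?_⟩
  · rw [ha, hb] at e1; linear_combination e1 / 8
  · rw [ha] at e2 ⊢; linear_combination e2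
  · linear_combination e3

section closure

variable {k F : Type*} [Field k] [Field F] [Algebra k F]

lemma mem_of_root (z : F) (p : (algebraicClosure k F)[X]) (hp : p ≠ 0)
    (h : aeval z p = 0) : z ∈ algebraicClosure k F := by
  rw [mem_algebraicClosure_iff]
  have : IsAlgebraic (algebraicClosure k F) z := ⟨p, hp, h⟩
  exact this.restrictScalars k

lemma mem_of_cubic (z α β γ : F) (hα : α ∈ algebraicClosure k F) (hβ : β ∈ algebraicClosure k F)
    (hγ : γ ∈ algebraicClosure k F) (h : z ^ 3 + α * z ^ 2 + β * z + γ = 0) :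
    z ∈ algebraicClosure k F := by
  let α' : algebraicClosure k F := ⟨α, hα⟩
  let β' : algebraicClosure k F := ⟨β, hβ⟩
  let γ' : algebraicClosure k F := ⟨γ, hγ⟩
  apply mem_of_root z (X ^ 3 + C α' * X ^ 2 + C β' * X + C γ')
  · intro h
    have := congrArg (fun p => coeff p 3) h
    simp [coeff_X, coeff_C] at this
  · simp only [map_add, map_mul, map_pow, aeval_X, aeval_C]
    exact h

lemma r0_mem [CharZero F] (s r0 a b d : F) (hs : s ∈ algebraicClosure k F)
    (hne : 256 + 224 * s ^ 2 + s ^ 4 ≠ 0)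
    (ha : a = r0 - s) (hb : b = 8 / 3 - 2 / 3 * r0 ^ 2 - 5 / 3 * r0 * s)
    (h2 : d * (36 * r0 + 18 * s) = -64 + 24 * s ^ 2 - 18 * a * b * r0 + 4 * a ^ 3 * r0
      - 2 * a ^ 2 * b + 12 * b ^ 2)
    (h3 : -18 * a * b * d + 4 * a ^ 3 * d + a ^ 2 * b ^ 2 - 4 * b ^ 3 - 27 * d ^ 2
      = s ^ 2 * (16 - 4 * s ^ 2)) : r0 ∈ algebraicClosure k F := by
  let s' : algebraicClosure k F := ⟨s, hs⟩
  have hcz : CharZero (algebraicClosure k F) := inferInstance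
  obtain ⟨A, hA⟩ : ∃ A, A = X - C s' := ⟨_, rfl⟩
  obtain ⟨B, hB⟩ : ∃ B, B = C (8 / 3) - C (2 / 3) * X ^ 2 - C (5 / 3) * X * C s' := ⟨_, rfl⟩
  obtain ⟨W, hW⟩ : ∃ W, W = C 36 * X + C 18 * C s' := ⟨_, rfl⟩
  obtain ⟨N, hN⟩ : ∃ N, N = - C 64 + C 24 * C s' ^ 2 - C 18 * A * B * X + C 4 * A ^ 3 * X
    - C 2 * A ^ 2 * B + C 12 * B ^ 2 := ⟨_, rfl⟩
  apply mem_of_root r0 (- C 18 * A * B * N * W + C 4 * A ^ 3 * N * W + A ^ 2 * B ^ 2 * W ^ 2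
    - C 4 * B ^ 3 * W ^ 2 - C 27 * N ^ 2 - C s' ^ 2 * (C 16 - C 4 * C s' ^ 2) * W ^ 2)
  · intro h
    have h := congrArg (eval (-s' / 2)) h
    have eA : eval (-s' / 2) A = - 3 / 2 * s' := by rw [hA]; simp; ring
    have eB : eval (-s' / 2) B = 8 / 3 + 2 / 3 * s' ^ 2 := by rw [hB]; simp; ring
    have eW : eval (-s' / 2) W = 0 := by rw [hW]; simp; ring
    have eN : eval (-s' / 2) N = (256 + 224 * s' ^ 2 + s' ^ 4) / 12 := by
      rw [hN]
      simp only [eval_add, eval_sub, eval_mul, eval_neg, eval_pow, eval_C, eval_X, eA, eB]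
      ring
    simp only [eval_add, eval_sub, eval_mul, eval_neg, eval_pow, eval_C, eval_X, eA, eB, eW, eN,
      eval_zero] at h
    have h' : (256 + 224 * s' ^ 2 + s' ^ 4) ^ 2 = 0 := by linear_combination (-16 / 3) * h
    have h'' := pow_eq_zero_iff (two_ne_zero) |>.1 h'
    apply hne
    have := congrArg (algebraMap (algebraicClosure k F) F) h''
    simp only [map_add, map_mul, map_pow, map_ofNat, map_zero] at this
    exact this
  · have eA : aeval r0 A = a := by rw [hA, ha]; simp; rfl
    have eB : aeval r0 B = b := by
      rw [hB, hb]; simp only [map_sub, map_mul, map_pow, aeval_C, aeval_X, map_div₀, map_ofNat]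
      rfl
    have eW : aeval r0 W = 36 * r0 + 18 * s := by
      rw [hW]; simp only [map_add, map_mul, aeval_C, aeval_X, map_ofNat]
      rfl
    have es : algebraMap (algebraicClosure k F) F s' = s := rfl
    have eN : aeval r0 N = d * (36 * r0 + 18 * s) := by
      rw [hN, h2]
      simp only [map_add, map_sub, map_mul, map_neg, map_pow, aeval_C, aeval_X, map_ofNat, eA, eB,
        es]
    simp only [map_add, map_sub, map_mul, map_neg, map_pow, aeval_C, aeval_X, map_ofNat, eA, eB,
        es, eN, eW]
    linear_combination (36 * r0 + 18 * s) ^ 2 * h3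

end closure

end Gessel

namespace Gessel

open Polynomial

lemma field_part {k F : Type*} [Field k] [Field F] [Algebra k F] [CharZero F]
    (x y t Z r1 δ p1 p2 p3 u v : F)
    (hx : x ∈ algebraicClosure k F) (hy : y ∈ algebraicClosure k F)
    (ht : t ∈ algebraicClosure k F)
    (y0 : y ≠ 0) (t0 : t ≠ 0) (n1 : 1 - 4 * t ≠ 0) (n2 : 1 + 4 * t ≠ 0)
    (n3 : 1 + 224 * t ^ 2 + 256 * t ^ 4 ≠ 0) (n4 : 1 + 2 * t * (t * Z) ≠ 0)
    (eX : t ^ 2 * ((u + x * (t * Z)) * (x * (x ^ 2 + 1) - t * (x ^ 2 + 1) ^ 2) + t * u ^ 3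
      + (t * (t * Z) - 1) * x * u ^ 2 + (2 * t - t * Z - 2 * t * (t * r1)) * x ^ 2 * u)
      = x ^ 3 * δ)
    (eY : (v + (1 + y) * t * (t * Z)) * (t ^ 2 * (1 - y ^ 2) ^ 2 + y ^ 2)
      + y * (v ^ 3 + (t * (t * Z) - 1) * (1 + y) * v ^ 2
      + t * (2 * t - t * Z - 2 * t * (t * r1)) * (1 + y) ^ 2 * v) = y * (1 + y) ^ 3 * δ)
    (a1 : t ^ 2 * ((p1 + t * Z) * (2 * 1 - 4 * t) + t * p1 ^ 3 + (t * (t * Z) - 1) * p1 ^ 2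
      + (2 * t - t * Z - 2 * t * (t * r1)) * p1) = δ)
    (b1 : (2 * 1 - 4 * t) + 3 * t * p1 ^ 2 + 2 * (t * (t * Z) - 1) * p1
      + (2 * t - t * Z - 2 * t * (t * r1)) = 0)
    (a2 : t ^ 2 * ((p2 + t * Z) * (2 * (-1) - 4 * t) + t * p2 ^ 3 + (t * (t * Z) - 1) * p2 ^ 2
      + (2 * t - t * Z - 2 * t * (t * r1)) * p2) = δ)
    (b2 : (2 * (-1) - 4 * t) + 3 * t * p2 ^ 2 + 2 * (t * (t * Z) - 1) * p2
      + (2 * t - t * Z - 2 * t * (t * r1)) = 0)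
    (a3 : p3 + 2 * t * (t * Z) + p3 ^ 3 + 2 * (t * (t * Z) - 1) * p3 ^ 2
      + 4 * t * (2 * t - t * Z - 2 * t * (t * r1)) * p3 = 8 * δ)
    (b3 : 1 + 3 * p3 ^ 2 + 4 * (t * (t * Z) - 1) * p3
      + 4 * t * (2 * t - t * Z - 2 * t * (t * r1)) = 0) :
    Z ∈ algebraicClosure k F ∧ u ∈ algebraicClosure k F ∧ v ∈ algebraicClosure k F := by
  obtain ⟨h1, h2, h3⟩ := solve t t⁻¹ (t * Z) (t * r1) (δ * t⁻¹ ^ 3) p1 p2 (p3 / (2 * t))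
    (inv_mul_cancel₀ t0) n1 n2 _ _ rfl rfl
    (by field_simp; linear_combination a1) (by field_simp; linear_combination b1)
    (by field_simp; linear_combination a2) (by field_simp; linear_combination b2)
    (by field_simp; linear_combination 4 * a3) (by field_simp; linear_combination 4 * b3)
  have hs : t⁻¹ ∈ algebraicClosure k F := inv_mem ht
  have hr0 : t * Z ∈ algebraicClosure k F := by
    refine r0_mem t⁻¹ (t * Z) _ _ (δ * t⁻¹ ^ 3) hs ?_ rfl ?_ h2 h3
    · intro h
      apply n3
      field_simp at h
      linear_combination h
    · linear_combination (-2 / 3) * h1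
  have hr1 : t * r1 ∈ algebraicClosure k F := by
    have : t * r1 = ((t * Z) ^ 2 + (t * Z) * t⁻¹ - 1) / 3 := by linear_combination h1 / 3
    rw [this]
    apply_rules [add_mem, sub_mem, mul_mem, pow_mem, div_mem, one_mem, ofNat_mem]
  have hδ : δ ∈ algebraicClosure k F := by
    have n5 : 36 * (t * Z) + 18 * t⁻¹ ≠ 0 := by
      intro h
      apply n4
      field_simp at h
      linear_combination h / 18
    have h6 := eq_div_of_mul_eq n5 h2
    have h7 : δ = δ * t⁻¹ ^ 3 * t ^ 3 := by field_simp
    have hA : t * Z - t⁻¹ ∈ algebraicClosure k F := sub_mem hr0 hs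
    have hB : 2 - t * Z * t⁻¹ - 2 * (t * r1) ∈ algebraicClosure k F := by
      apply_rules [add_mem, sub_mem, mul_mem, ofNat_mem]
    rw [h7, h6]
    generalize t * Z - t⁻¹ = A at hA ⊢
    generalize 2 - t * Z * t⁻¹ - 2 * (t * r1) = B at hB ⊢
    refine mul_mem (div_mem ?_ ?_) (pow_mem ht 3)
    · repeat' first
        | assumption | apply add_mem | apply sub_mem | apply mul_mem | apply pow_mem
        | apply neg_mem | apply ofNat_mem
    · apply_rules [add_mem, mul_mem, ofNat_mem]
  have hZ : Z ∈ algebraicClosure k F := by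
    have : Z = t * Z * t⁻¹ := by field_simp
    rw [this]; exact mul_mem hr0 hs
  refine ⟨hZ, ?_, ?_⟩
  · apply mem_of_cubic u ((t * Z - t⁻¹) * x) (x ^ 2 * (2 - (t * Z) * t⁻¹ - 2 * (t * r1))
      + t⁻¹ * x * (x ^ 2 + 1) - (x ^ 2 + 1) ^ 2)
      (x * (t * Z) * (t⁻¹ * x * (x ^ 2 + 1) - (x ^ 2 + 1) ^ 2) - x ^ 3 * δ * t⁻¹ ^ 3)
    · apply_rules [add_mem, sub_mem, mul_mem, pow_mem, div_mem, one_mem, ofNat_mem, neg_mem]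
    · apply_rules [add_mem, sub_mem, mul_mem, pow_mem, div_mem, one_mem, ofNat_mem, neg_mem]
    · apply_rules [add_mem, sub_mem, mul_mem, pow_mem, div_mem, one_mem, ofNat_mem, neg_mem]
    · field_simp
      linear_combination eX
  · apply mem_of_cubic v ((t * (t * Z) - 1) * (1 + y))
      (t * (2 * t - t * Z - 2 * t * (t * r1)) * (1 + y) ^ 2
        + (t ^ 2 * (1 - y ^ 2) ^ 2 + y ^ 2) / y)
      ((1 + y) * t * (t * Z) * ((t ^ 2 * (1 - y ^ 2) ^ 2 + y ^ 2) / y) - (1 + y) ^ 3 * δ)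
    · apply_rules [add_mem, sub_mem, mul_mem, pow_mem, div_mem, one_mem, ofNat_mem, neg_mem]
    · apply_rules [add_mem, sub_mem, mul_mem, pow_mem, div_mem, one_mem, ofNat_mem, neg_mem]
    · apply_rules [add_mem, sub_mem, mul_mem, pow_mem, div_mem, one_mem, ofNat_mem, neg_mem]
    · field_simp
      linear_combination eY

end Gessel

namespace Gessel

open Polynomial

/-- The fraction field of the ring of series. -/
abbrev FW := FractionRing PW

noncomputable def φ : PW →+* FW := algebraMap PW FW

lemma φ_inj : Function.Injective φ := IsFractionRing.injective PW FW

lemma ne_of_const (z : PowerSeries ℚ) (h : PowerSeries.constantCoeff z ≠ 0) :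
    φ (ιx (ι0 z)) ≠ 0 := by
  intro h0
  apply h
  have : z = 0 := by
    apply ι0_inj; apply ιx_inj; apply φ_inj
    simpa using h0
  rw [this, map_zero]

instance : CharZero FW := by
  have : CharZero PW := algebraRat.charZero PW
  exact charZero_of_injective_ringHom φ_inj

lemma yW_ne : yW ≠ 0 := by
  intro h
  have := congrArg ex0 h
  rw [ex0_yW, map_zero] at this
  exact xv_ne this

lemma LW_ne : LW ≠ 0 := by
  intro h
  have := congrArg PowerSeries.constantCoeff h
  simp [LW, xW, yW, tW] at this

set_option maxHeartbeats 1000000 in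
lemma Qs_mem {k : Type*} [Field k] [Algebra k FW] (hx : φ xW ∈ algebraicClosure k FW)
    (hy : φ yW ∈ algebraicClosure k FW) (ht : φ tW ∈ algebraicClosure k FW) :
    φ Qs ∈ algebraicClosure k FW := by
  obtain ⟨r1, δ, eX, eY⟩ := main_cubic
  obtain ⟨p1, a1, b1⟩ := pt1 r1 δ Zs PowerSeries.X rfl rfl eX 1 (by norm_num)
  obtain ⟨p2, a2, b2⟩ := pt1 r1 δ Zs PowerSeries.X rfl rfl eX (-1) (by norm_num)
  obtain ⟨p3, a3, b3⟩ := pt2 r1 δ Zs PowerSeries.X rfl rfl eY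
  let ψ : PowerSeries ℚ →+* FW := (φ.comp ιx).comp ι0
  have ψX : ψ PowerSeries.X = φ tW := by
    change φ (ιx (ι0 _)) = _
    rw [ι0_X, ιx_tX]
  have x0 : φ xW ≠ 0 := fun h => xW_ne (φ_inj (by rw [h, map_zero]))
  have y0 : φ yW ≠ 0 := fun h => yW_ne (φ_inj (by rw [h, map_zero]))
  have t0 : φ tW ≠ 0 := fun h =>
    PowerSeries.X_ne_zero (R := ℚ[X][X]) (φ_inj (by rw [map_zero]; exact h))
  have L0 : φ LW ≠ 0 := fun h => LW_ne (φ_inj (by rw [h, map_zero]))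
  have n1 : 1 - 4 * φ tW ≠ 0 := by
    have := ne_of_const (1 - 4 * PowerSeries.X) (by simp)
    change ψ _ ≠ 0 at this
    simpa only [map_sub, map_mul, map_one, map_ofNat, ψX] using this
  have n2 : 1 + 4 * φ tW ≠ 0 := by
    have := ne_of_const (1 + 4 * PowerSeries.X) (by simp)
    change ψ _ ≠ 0 at this
    simpa only [map_add, map_mul, map_one, map_ofNat, ψX] using this
  have n3 : 1 + 224 * φ tW ^ 2 + 256 * φ tW ^ 4 ≠ 0 := by
    have := ne_of_const (1 + 224 * PowerSeries.X ^ 2 + 256 * PowerSeries.X ^ 4) (by simp)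
    change ψ _ ≠ 0 at this
    simpa only [map_add, map_mul, map_pow, map_one, map_ofNat, ψX] using this
  have n4 : 1 + 2 * φ tW * (φ tW * ψ Zs) ≠ 0 := by
    have := ne_of_const (1 + 2 * PowerSeries.X * (PowerSeries.X * Zs)) (by simp)
    change ψ _ ≠ 0 at this
    simpa only [map_add, map_mul, map_pow, map_one, map_ofNat, ψX] using this
  have hψ : ∀ z, φ (ιx (ι0 z)) = ψ z := fun _ => rfl
  have a1' := congrArg ψ a1
  have b1' := congrArg ψ b1
  have a2' := congrArg ψ a2
  have b2' := congrArg ψ b2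
  have a3' := congrArg ψ a3
  have b3' := congrArg ψ b3
  have eX' := congrArg (fun f => φ (ιx f)) eX
  have eY' := congrArg (fun f => φ (ιy f)) eY
  simp only [map_add, map_sub, map_mul, map_pow, map_one, map_ofNat, map_zero, map_neg, ψX,
    ιx_xv, ιx_tX, ιy_xv, ιy_tX, ιy_ι0, hψ] at a1' b1' a2' b2' a3' b3' eX' eY'
  obtain ⟨hZ, hu, hv⟩ := field_part _ _ _ _ _ _ _ _ _ _ _ hx hy ht y0 t0 n1 n2 n3 n4 eX' eY'
    a1' b1' a2' b2' a3' b3'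
  have hR : φ (ιx Rs) ∈ algebraicClosure k FW := by
    have e : φ (ιx uX) = 1 + φ xW * φ tW * (φ (ιx Rs) - ψ Zs) := by
      rw [uX]
      simp only [map_add, map_sub, map_mul, map_one, ιx_xv, ιx_tX, hψ]
    have : φ (ιx Rs) = (φ (ιx uX) - 1) / (φ xW * φ tW) + ψ Zs := by
      rw [e]; field_simp; ring
    rw [this]
    exact add_mem (div_mem (sub_mem hu (one_mem _)) (mul_mem hx ht)) hZ
  have hS : φ tW * (1 + φ yW) * φ (ιy Ss) ∈ algebraicClosure k FW := by
    have z0 : (1 + φ yW) ≠ 0 := by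
      intro h
      have h2 : (1 + yW : PW) = 0 := φ_inj (by rw [map_add, map_one, h, map_zero])
      have := congrArg (fun f => PowerSeries.constantCoeff (ex0 f)) h2
      simp [ex0_yW, xv] at this
      have := congrArg (eval 0) this
      simp at this
    have e : φ (ιy vX) = φ yW - φ tW ^ 2 * (1 + φ yW) ^ 2 * φ (ιy Ss) := by
      rw [vX]
      simp only [map_add, map_sub, map_mul, map_pow, map_one, ιy_xv, ιy_tX]
    have : φ tW * (1 + φ yW) * φ (ιy Ss) = (φ yW - φ (ιy vX)) / (φ tW * (1 + φ yW)) := by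
      rw [e]; field_simp; ring
    rw [this]
    exact div_mem (sub_mem hy hv) (mul_mem ht (add_mem (one_mem _) hy))
  have hL : φ LW ∈ algebraicClosure k FW := by
    rw [LW]
    simp only [map_add, map_sub, map_mul, map_pow, map_one]
    exact sub_mem (mul_mem hx hy) (mul_mem ht (mul_mem (add_mem (one_mem _) hy)
      (add_mem (one_mem _) (mul_mem (pow_mem hx 2) hy))))
  have h := congrArg φ funeq
  rw [map_mul] at h
  have h2 : φ Qs = (φ xW * φ yW - φ tW * φ (ιx Rs) - φ tW * (1 + φ yW) * φ (ιy Ss)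
      + φ tW * ψ Zs) / φ LW := by
    rw [eq_div_iff L0, mul_comm, h]
    simp only [map_add, map_sub, map_mul, map_one, hψ]
  rw [h2]
  refine div_mem (add_mem (sub_mem (sub_mem ?_ ?_) hS) ?_) hL
  · exact mul_mem hx hy
  · exact mul_mem ht hR
  · exact mul_mem ht hZ

open scoped IntermediateField.algebraAdjoinAdjoin in
lemma exists_poly : ∃ P : MvPolynomial (Fin 4) ℚ, P ≠ 0 ∧
    MvPolynomial.aeval ![xW, yW, tW, Qs] P = 0 := by
  let w : Fin 4 → FW := ![φ xW, φ yW, φ tW, φ Qs]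
  let k := IntermediateField.adjoin ℚ (w '' {3}ᶜ)
  have hm : ∀ i : Fin 4, i ≠ 3 → w i ∈ algebraicClosure k FW := by
    intro i hi
    have h1 : w i ∈ k := IntermediateField.subset_adjoin _ _ ⟨i, hi, rfl⟩
    exact (algebraicClosure k FW).algebraMap_mem ⟨w i, h1⟩
  have hQ := Qs_mem (k := k) (hm 0 (by decide)) (hm 1 (by decide)) (hm 2 (by decide))
  rw [mem_algebraicClosure_iff] at hQ
  have hQ' : IsAlgebraic (Algebra.adjoin ℚ (w '' {3}ᶜ)) (w 3) :=
    hQ.restrictScalars (Algebra.adjoin ℚ (w '' {3}ᶜ))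
  have hn : ¬ AlgebraicIndependent ℚ w := by
    intro h
    exact ((AlgebraicIndependent.iff_transcendental_adjoin_image (x := w) 3).1 h).2 hQ'
  rw [algebraicIndependent_iff] at hn
  push Not at hn
  obtain ⟨P, hP, hP0⟩ := hn
  refine ⟨P, hP0, ?_⟩
  apply φ_inj
  rw [map_zero, ← hP, MvPolynomial.aeval_def, MvPolynomial.aeval_def, MvPolynomial.hom_eval₂]
  have e1 : φ.comp (algebraMap ℚ PW) = algebraMap ℚ FW := Subsingleton.elim _ _
  have e2 : (fun i => φ (![xW, yW, tW, Qs] i)) = w := by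
    funext i
    fin_cases i <;> rfl
  rw [e1, e2]

end Gessel

namespace Gessel

open Polynomial

/-- Exponent vectors with three entries. -/
noncomputable def exps (i j n : ℕ) : Fin 3 →₀ ℕ := Finsupp.equivFunOnFinite.symm ![i, j, n]

lemma exps_zero (i j n : ℕ) : exps i j n 0 = i := rfl
lemma exps_one (i j n : ℕ) : exps i j n 1 = j := rfl
lemma exps_two (i j n : ℕ) : exps i j n 2 = n := rfl

lemma exps_ext {d e : Fin 3 →₀ ℕ} (h0 : d 0 = e 0) (h1 : d 1 = e 1) (h2 : d 2 = e 2) :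
    d = e := by
  ext i
  fin_cases i
  · exact h0
  · exact h1
  · exact h2

/-- The comparison map on the level of functions. -/
noncomputable def θf (f : PW) : MvPowerSeries (Fin 3) ℚ :=
  fun d => ((PowerSeries.coeff (d 2) f).coeff (d 1)).coeff (d 0)

lemma coeff_θf (f : PW) (d : Fin 3 →₀ ℕ) : MvPowerSeries.coeff d (θf f) =
    ((PowerSeries.coeff (d 2) f).coeff (d 1)).coeff (d 0) := rfl

lemma θf_mul (f g : PW) : θf (f * g) = θf f * θf g := by
  refine MvPowerSeries.ext fun d => ?_
  rw [MvPowerSeries.coeff_mul, coeff_θf, PowerSeries.coeff_mul]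
  simp only [coeff_θf, finsetSum_coeff, coeff_mul]
  simp only [← Finset.sum_product']
  refine Finset.sum_nbij' (fun p => (exps p.2.2.1 p.2.1.1 p.1.1, exps p.2.2.2 p.2.1.2 p.1.2))
    (fun p => ((p.1 2, p.2 2), (p.1 1, p.2 1), (p.1 0, p.2 0))) ?_ ?_ ?_ ?_ ?_
  · rintro ⟨⟨a, b⟩, ⟨c, d⟩, ⟨e, f⟩⟩ h
    simp only [Finset.mem_product, Finset.HasAntidiagonal.mem_antidiagonal] at h ⊢
    exact exps_ext h.2.2 h.2.1 h.1
  · rintro ⟨a, b⟩ h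
    simp only [Finset.mem_product, Finset.HasAntidiagonal.mem_antidiagonal] at h ⊢
    subst h
    exact ⟨rfl, rfl, rfl⟩
  · rintro ⟨⟨a, b⟩, ⟨c, d⟩, ⟨e, f⟩⟩ h
    rfl
  · rintro ⟨a, b⟩ h
    exact Prod.ext (exps_ext rfl rfl rfl) (exps_ext rfl rfl rfl)
  · rintro ⟨⟨a, b⟩, ⟨c, d⟩, ⟨e, f⟩⟩ h
    rfl

lemma θf_one : θf 1 = 1 := by
  refine MvPowerSeries.ext fun d => ?_
  rw [coeff_θf, MvPowerSeries.coeff_one, PowerSeries.coeff_one]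
  by_cases h2 : d 2 = 0
  · by_cases h1 : d 1 = 0
    · by_cases h0 : d 0 = 0
      · have : d = 0 := exps_ext h0 h1 h2
        simp [this]
      · have : d ≠ 0 := fun h => h0 (by rw [h]; rfl)
        simp [this, h0, h1, h2, coeff_one]
    · have : d ≠ 0 := fun h => h1 (by rw [h]; rfl)
      simp [this, h1, h2, coeff_one]
  · have : d ≠ 0 := fun h => h2 (by rw [h]; rfl)
    simp [this, h2]

/-- The comparison map. -/
noncomputable def θ : PW →+* MvPowerSeries (Fin 3) ℚ where
  toFun := θf
  map_one' := θf_one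
  map_mul' := θf_mul
  map_zero' := by
    refine MvPowerSeries.ext fun d => ?_
    rw [coeff_θf]; simp
  map_add' f g := by
    refine MvPowerSeries.ext fun d => ?_
    rw [map_add]; simp only [coeff_θf, map_add, coeff_add]

lemma coeff_θ (f : PW) (d : Fin 3 →₀ ℕ) : MvPowerSeries.coeff d (θ f) =
    ((PowerSeries.coeff (d 2) f).coeff (d 1)).coeff (d 0) := rfl

lemma eq_single_iff (d : Fin 3 →₀ ℕ) (i : Fin 3) : d = Finsupp.single i 1 ↔
    d 0 = (if i = 0 then 1 else 0) ∧ d 1 = (if i = 1 then 1 else 0)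
      ∧ d 2 = (if i = 2 then 1 else 0) := by
  constructor
  · rintro rfl
    simp [Finsupp.single_apply]
  · rintro ⟨h0, h1, h2⟩
    apply exps_ext
    · simpa [Finsupp.single_apply] using h0
    · simpa [Finsupp.single_apply] using h1
    · simpa [Finsupp.single_apply] using h2

lemma θ_xW : θ xW = MvPowerSeries.X 0 := by
  refine MvPowerSeries.ext fun d => ?_
  rw [coeff_θ, MvPowerSeries.coeff_X, xW, PowerSeries.coeff_C]
  simp only [eq_single_iff]
  by_cases h2 : d 2 = 0 <;> by_cases h1 : d 1 = 0 <;> by_cases h0 : 1 = d 0 <;>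
    simp [h0, eq_comm (b := 1), h1, h2, coeff_X, coeff_C]

lemma θ_yW : θ yW = MvPowerSeries.X 1 := by
  refine MvPowerSeries.ext fun d => ?_
  rw [coeff_θ, MvPowerSeries.coeff_X, yW, PowerSeries.coeff_C]
  simp only [eq_single_iff]
  by_cases h2 : d 2 = 0 <;> by_cases h1 : 1 = d 1 <;> by_cases h0 : d 0 = 0 <;>
    simp [h0, h1, eq_comm (b := 1), h2, coeff_X, coeff_one]

lemma θ_tW : θ tW = MvPowerSeries.X 2 := by
  refine MvPowerSeries.ext fun d => ?_
  rw [coeff_θ, MvPowerSeries.coeff_X, tW, PowerSeries.coeff_X]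
  simp only [eq_single_iff]
  by_cases h2 : d 2 = 1 <;> by_cases h1 : d 1 = 0 <;> by_cases h0 : d 0 = 0 <;>
    simp [h0, h1, h2, coeff_one]

lemma θ_Qs : θ Qs = Q gesselSteps := by
  refine MvPowerSeries.ext fun d => ?_
  rw [coeff_θ, Qs, PowerSeries.coeff_mk, Qn_coeff]
  rfl

end Gessel

/-- For Gessel's model, the trivariate generating function `Q(x,y;t)` is algebraic:
some nonzero polynomial `P ∈ ℚ[x,y,t,u]` satisfies `P(x,y,t,Q(x,y;t)) = 0`. -/
theorem gessel_algebraic :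
    ∃ P : MvPolynomial (Fin 4) ℚ, P ≠ 0 ∧
      MvPolynomial.aeval
        ![MvPowerSeries.X 0, MvPowerSeries.X 1, MvPowerSeries.X 2, Q gesselSteps] P = 0 := by
  obtain ⟨P, hP0, hP⟩ := Gessel.exists_poly
  refine ⟨P, hP0, ?_⟩
  have h := congrArg Gessel.θ hP
  rw [map_zero, MvPolynomial.aeval_def, MvPolynomial.hom_eval₂] at h
  rw [← h, MvPolynomial.aeval_def]
  have e1 : Gessel.θ.comp (algebraMap ℚ Gessel.PW) = algebraMap ℚ (MvPowerSeries (Fin 3) ℚ) :=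
    Subsingleton.elim _ _
  have e2 : (fun i => Gessel.θ (![Gessel.xW, Gessel.yW, Gessel.tW, Gessel.Qs] i))
      = ![MvPowerSeries.X 0, MvPowerSeries.X 1, MvPowerSeries.X 2, Q gesselSteps] := by
    funext i
    fin_cases i
    · exact Gessel.θ_xW
    · exact Gessel.θ_yW
    · exact Gessel.θ_tW
    · exact Gessel.θ_Qs
  rw [e1, e2]
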